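/- Let I ⊆ V be a set (of client input values) and consider an execution σ₀, …, σ_N such that every write-once step writing a non-nil value v satisfies: v ∈ I, or some server s and register set i have σ s i = some (some v) at the step's pre-state σ. Then every non-nil value present in σ_N lies in I (if σ_N s r = some (some v) then v ∈ I); in particular, every value decided in any register set at σ_N lies in I. -/

import Mathlib

/-- `Decided 𝒬 σ r v`: the value `v` is decided in register set `r` at state
`σ`, i.e. some quorum `Q ∈ 𝒬 r` has `σ s r = some (some v)` for all `s ∈ Q`. -/
def Decided {S V : Type*} (𝒬 : ℕ → Set (Set S))
    (σ : S → ℕ → Option (Option V)) (r : ℕ) (v : V) : Prop :=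
  ∃ Q ∈ 𝒬 r, ∀ s ∈ Q, σ s r = some (some v)

/-- `Step σ σ' s r x`: a write-once step from `σ` to `σ'` writing `x` to the
previously unwritten register `r` on server `s`, leaving all else unchanged. -/
def Step {S V : Type*} (σ σ' : S → ℕ → Option (Option V))
    (s : S) (r : ℕ) (x : Option V) : Prop :=
  σ s r = none ∧ σ' s r = some x ∧
    ∀ (s' : S) (r' : ℕ), ¬(s' = s ∧ r' = r) → σ' s' r' = σ s' r'

/-- **Non-triviality (Rule 2).**
In an execution `σ 0, …, σ N` starting from the everywhere-unwritten state, if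
every write-once step writing a non-nil value `v` has `v ∈ I` or `v` already
present (non-nil) in some register of the pre-state, then every non-nil value
present in `σ N` lies in `I`; in particular, every value decided in any
register set at `σ N` lies in `I`. Quorums are non-empty subsets of servers. -/
theorem non_triviality
    {S V : Type*} [Fintype S]
    (𝒬 : ℕ → Set (Set S)) (N : ℕ) (σ : ℕ → S → ℕ → Option (Option V))
    (I : Set V)
    (hQne : ∀ r, ∀ Q ∈ 𝒬 r, Q.Nonempty)
    (h0 : ∀ (s : S) (r : ℕ), σ 0 s r = none)
    (hstep : ∀ k < N, ∃ (s : S) (r : ℕ) (x : Option V),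
      Step (σ k) (σ (k + 1)) s r x ∧
      ∀ v : V, x = some v → v ∈ I ∨ ∃ (s' : S) (i : ℕ), σ k s' i = some (some v)) :
    (∀ (s : S) (r : ℕ) (v : V), σ N s r = some (some v) → v ∈ I) ∧
    (∀ (r : ℕ) (v : V), Decided 𝒬 (σ N) r v → v ∈ I) := by
  have hmem : ∀ k ≤ N, ∀ (s : S) (r : ℕ) (v : V), σ k s r = some (some v) → v ∈ I := by
    intro k
    induction k with
    | zero =>
      intro _ s r v hv
      simp [h0] at hv
    | succ k ih =>
      intro hk s r v hv
      obtain ⟨t, q, x, ⟨-, hx, hrest⟩, hval⟩ := hstep k hk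
      have ih := ih (Nat.le_of_succ_le hk)
      by_cases h : s = t ∧ r = q
      · obtain ⟨rfl, rfl⟩ := h
        rcases hval v (Option.some.inj (hx.symm.trans hv)) with hI | ⟨s', i, hi⟩
        · exact hI
        · exact ih s' i v hi
      · exact ih s r v ((hrest s r h).symm.trans hv)
  refine ⟨hmem N le_rfl, ?_⟩
  rintro r v ⟨Q, hQ, hdec⟩
  obtain ⟨s, hs⟩ := hQne r Q hQ
  exact hmem N le_rfl s r v (hdec s hs)
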